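/- arXiv:0708.0347 — 9 statements merged into one kernel-verified Lean document; each statement's English description precedes it below -/
import Mathlib

section
/- Let a > 0, b ∈ ℝ and Ω > 0 satisfy |b| < Ω, and set α = (Ω² − b²)/a. If γ > 0 and ω ∈ ℝ with |ω| ≤ Ω, then |exp(γ·(iω − a + i·b)/(iω + α − i·b))| ≤ 1, and consequently |1 − exp(γ·(iω − a + i·b)/(iω + α − i·b))| ≤ 2. -/
open Complex

/-- The quotient of `z` by `w` has nonpositive real part when `Re (z * conj w) ≤ 0`. -/
theorem Complex.div_re_nonpos {z w : ℂ} (h : z.re * w.re + z.im * w.im ≤ 0) : (z / w).re ≤ 0 := by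
  rw [Complex.div_re, ← add_div]
  exact div_nonpos_of_nonpos_of_nonneg h (Complex.normSq_nonneg w)

theorem exp_factor_bound_lowband
    (a b Ω : ℝ) (ha : 0 < a) (hΩ : 0 < Ω) (hb : |b| < Ω)
    (α : ℝ) (hα : α = (Ω ^ 2 - b ^ 2) / a)
    (γ ω : ℝ) (hγ : 0 < γ) (hω : |ω| ≤ Ω) :
    ‖Complex.exp ((γ : ℂ) *
        ((Complex.I * ω - a + Complex.I * b) / (Complex.I * ω + α - Complex.I * b)))‖ ≤ 1 ∧
    ‖1 - Complex.exp ((γ : ℂ) *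
        ((Complex.I * ω - a + Complex.I * b) / (Complex.I * ω + α - Complex.I * b)))‖ ≤ 2 := by
  have hnorm : ‖Complex.exp ((γ : ℂ) *
      ((Complex.I * ω - a + Complex.I * b) / (Complex.I * ω + α - Complex.I * b)))‖ ≤ 1 := by
    rw [Complex.norm_exp, Real.exp_le_one_iff, Complex.re_ofReal_mul]
    refine mul_nonpos_of_nonneg_of_nonpos hγ.le (Complex.div_re_nonpos ?_)
    have haα : a * α = Ω ^ 2 - b ^ 2 := by
      rw [hα]
      field_simp
    have hωΩ : ω ^ 2 ≤ Ω ^ 2 := sq_le_sq' (abs_le.mp hω).1 (abs_le.mp hω).2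
    simp
    linarith
  refine ⟨hnorm, (norm_sub_le _ _).trans ?_⟩
  rw [norm_one]
  linarith
end

section
/- Let a > 0, b ∈ ℝ and Ω > 0 satisfy |b| < Ω, and set α = (Ω² − b²)/a. If γ < 0 and ω ∈ ℝ with |ω| ≥ Ω, then |exp(γ·(iω − a + i·b)/(iω + α − i·b))| ≤ 1, and consequently |1 − exp(γ·(iω − a + i·b)/(iω + α − i·b))| ≤ 2. -/
open Complex

theorem exp_factor_bound_highband
    (a b Ω : ℝ) (ha : 0 < a) (hΩ : 0 < Ω) (hb : |b| < Ω)
    (α : ℝ) (hα : α = (Ω ^ 2 - b ^ 2) / a)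
    (γ ω : ℝ) (hγ : γ < 0) (hω : Ω ≤ |ω|) :
    ‖Complex.exp ((γ : ℂ) *
        ((Complex.I * ω - a + Complex.I * b) / (Complex.I * ω + α - Complex.I * b)))‖ ≤ 1 ∧
    ‖1 - Complex.exp ((γ : ℂ) *
        ((Complex.I * ω - a + Complex.I * b) / (Complex.I * ω + α - Complex.I * b)))‖ ≤ 2 := by
  have hre : 0 ≤ ((Complex.I * ω - a + Complex.I * b) /
      (Complex.I * ω + α - Complex.I * b) : ℂ).re := by
    have haα : a * α = Ω ^ 2 - b ^ 2 := by
      rw [hα]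
      field_simp
    have hsq : Ω ^ 2 ≤ ω ^ 2 := by
      rw [← sq_abs ω]
      gcongr
    rw [Complex.div_re, ← add_div]
    refine div_nonneg ?_ (Complex.normSq_nonneg _)
    simp
    linarith
  have hexp : ‖Complex.exp ((γ : ℂ) *
      ((Complex.I * ω - a + Complex.I * b) / (Complex.I * ω + α - Complex.I * b)))‖ ≤ 1 := by
    rw [Complex.norm_exp, Complex.re_ofReal_mul, Real.exp_le_one_iff]
    exact mul_nonpos_of_nonpos_of_nonneg hγ.le hre
  refine ⟨hexp, (norm_sub_le _ _).trans ?_⟩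
  rw [norm_one]
  linarith
end

section
/- For every fixed ω ∈ ℝ with |ω| < Ω, V_γ(iω) → 1 as γ → +∞. -/
open Complex Filter

theorem tendsto_cexp_ofReal_mul_atTop {z : ℂ} (hz : z.re < 0) :
    Tendsto (fun γ : ℝ => Complex.exp ((γ : ℂ) * z)) atTop (nhds 0) := by
  rw [tendsto_exp_nhds_zero_iff]
  simpa only [re_ofReal_mul, id] using tendsto_id.atTop_mul_const_of_neg hz

theorem re_allpass_exponent_neg {Ω ω a b α : ℝ} (ha : 0 < a) (hb : |b| < Ω)
    (hα : α = (Ω ^ 2 - b ^ 2) / a) (hω : |ω| < Ω) :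
    ((Complex.I * ω - a + Complex.I * b) / (Complex.I * ω + α - Complex.I * b)).re < 0 := by
  have hb2 : b ^ 2 < Ω ^ 2 := sq_lt_sq.2 (hb.trans_le (le_abs_self Ω))
  have hω2 : ω ^ 2 < Ω ^ 2 := sq_lt_sq.2 (hω.trans_le (le_abs_self Ω))
  have hα0 : 0 < α := hα ▸ div_pos (sub_pos.2 hb2) ha
  have haα : a * α = Ω ^ 2 - b ^ 2 := by rw [hα]; field_simp
  have hpos : 0 < normSq (Complex.I * ω + α - Complex.I * b) := by
    refine normSq_pos.2 fun h => hα0.ne' ?_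
    simpa using congrArg Complex.re h
  rw [div_re, ← add_div]
  refine div_neg_of_neg_of_pos ?_ hpos
  simp
  nlinarith

theorem V_tendsto_one_lowband
    (Ω : ℝ) (hΩ : 0 < Ω) (n : ℕ) (hn : 1 ≤ n)
    (a b : Fin n → ℝ) (ha : ∀ m, 0 < a m) (hb : ∀ m, |b m| < Ω)
    (α : Fin n → ℝ) (hα : ∀ m, α m = (Ω ^ 2 - b m ^ 2) / a m)
    (V : ℝ → ℂ → ℂ)
    (hV : ∀ (γ : ℝ) (p : ℂ), V γ p =
      ∏ m, (1 - Complex.exp ((γ : ℂ) *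
        ((p - a m + Complex.I * b m) / (p + α m - Complex.I * b m)))))
    (ω : ℝ) (hω : |ω| < Ω) :
    Tendsto (fun γ : ℝ => V γ (Complex.I * ω)) atTop (nhds 1) := by
  simp only [hV]
  have h : ∀ m ∈ Finset.univ, Tendsto (fun γ : ℝ => 1 - Complex.exp ((γ : ℂ) *
      ((Complex.I * ω - a m + Complex.I * b m) / (Complex.I * ω + α m - Complex.I * b m))))
      atTop (nhds 1) := fun m _ => by
    simpa using (tendsto_cexp_ofReal_mul_atTop
      (re_allpass_exponent_neg (ha m) (hb m) (hα m) hω)).const_sub 1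
  simpa using tendsto_finsetProd Finset.univ h
end

section
/- For every fixed ω ∈ ℝ with |ω| > Ω, V_γ(iω) → 1 as γ → −∞. -/
open Complex Filter

/-- If `0 < c.re`, then `exp (γ * c)` vanishes as the real parameter `γ` tends to `-∞`. -/
theorem tendsto_exp_ofReal_mul_atBot {c : ℂ} (hc : 0 < c.re) :
    Tendsto (fun γ : ℝ => Complex.exp ((γ : ℂ) * c)) atBot (nhds 0) := by
  rw [Complex.tendsto_exp_nhds_zero_iff]
  simpa using tendsto_id.atBot_mul_const hc

/-- Above the band `|ω| ≤ Ω`, each Möbius exponent has positive real part on the imaginary axis. -/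
theorem re_exponent_pos {Ω a b α ω : ℝ} (ha : 0 < a) (hb : |b| < Ω)
    (hα : α = (Ω ^ 2 - b ^ 2) / a) (hω : Ω < |ω|) :
    0 < ((Complex.I * ω - a + Complex.I * b) / (Complex.I * ω + α - Complex.I * b)).re := by
  have hb2 : b ^ 2 < Ω ^ 2 := sq_lt_sq.2 (hb.trans_le (le_abs_self Ω))
  have hω2 : Ω ^ 2 < ω ^ 2 :=
    sq_lt_sq.2 (by rwa [abs_of_nonneg ((abs_nonneg b).trans hb.le)])
  have hα_pos : 0 < α := hα ▸ div_pos (sub_pos.2 hb2) ha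
  have haα : a * α = Ω ^ 2 - b ^ 2 := by rw [hα]; field_simp
  rw [Complex.div_re, ← add_div]
  apply div_pos
  · simp
    nlinarith
  · rw [Complex.normSq_pos]
    intro h
    have hre := congrArg Complex.re h
    simp at hre
    exact hα_pos.ne' hre

theorem V_tendsto_one_highband
    (Ω : ℝ) (hΩ : 0 < Ω) (n : ℕ) (hn : 1 ≤ n)
    (a b : Fin n → ℝ) (ha : ∀ m, 0 < a m) (hb : ∀ m, |b m| < Ω)
    (α : Fin n → ℝ) (hα : ∀ m, α m = (Ω ^ 2 - b m ^ 2) / a m)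
    (V : ℝ → ℂ → ℂ)
    (hV : ∀ (γ : ℝ) (p : ℂ), V γ p =
      ∏ m, (1 - Complex.exp ((γ : ℂ) *
        ((p - a m + Complex.I * b m) / (p + α m - Complex.I * b m)))))
    (ω : ℝ) (hω : Ω < |ω|) :
    Tendsto (fun γ : ℝ => V γ (Complex.I * ω)) atBot (nhds 1) := by
  simp only [hV]
  rw [← Finset.prod_const_one (s := (Finset.univ : Finset (Fin n)))]
  refine tendsto_finsetProd _ fun m _ => ?_
  simpa using (tendsto_exp_ofReal_mul_atBot
    (re_exponent_pos (ha m) (hb m) (hα m) hω)).const_sub 1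
end

section
/- For every ε ∈ (0, Ω), the supremum over ω ∈ [−Ω+ε, Ω−ε] of |V_γ(iω) − 1| tends to 0 as γ → +∞; that is, V_γ(iω) → 1 uniformly on [−Ω+ε, Ω−ε] as γ → +∞. -/
open Complex Filter

/-- On the imaginary axis the exponent of each factor has real part
`(ω² - Ω²) / (α² + (ω - b)²)` whenever `a * α = Ω² - b²`. -/
lemma re_exponent_imaginary_axis {Ω a b α : ℝ} (h : a * α = Ω ^ 2 - b ^ 2) (ω : ℝ) :
    ((I * ω - a + I * b) / (I * ω + α - I * b) : ℂ).re =
      (ω ^ 2 - Ω ^ 2) / (α ^ 2 + (ω - b) ^ 2) := by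
  rw [Complex.div_re, ← add_div]
  have hd : normSq (I * ω + α - I * b) = α ^ 2 + (ω - b) ^ 2 := by
    simp [normSq_apply]
    ring
  rw [hd]
  congr 1
  simp
  linear_combination -h

/-- Uniform decay of the exponential factor on the band `|ω| ≤ Ω - ε`. -/
lemma norm_exp_exponent_le {Ω ε a b α γ ω : ℝ} (hε : 0 < ε) (hεΩ : ε < Ω) (hb : |b| < Ω)
    (hα : 0 < α) (h : a * α = Ω ^ 2 - b ^ 2) (hγ : 0 ≤ γ)
    (hω : ω ∈ Set.Icc (-Ω + ε) (Ω - ε)) :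
    ‖Complex.exp (γ * ((I * ω - a + I * b) / (I * ω + α - I * b)))‖ ≤
      Real.exp (-(γ * ((Ω ^ 2 - (Ω - ε) ^ 2) / (α ^ 2 + (2 * Ω) ^ 2)))) := by
  obtain ⟨hω₁, hω₂⟩ := hω
  obtain ⟨hb₁, hb₂⟩ := abs_lt.mp hb
  rw [Complex.norm_exp, Complex.re_ofReal_mul, re_exponent_imaginary_axis h, ← mul_neg]
  gcongr
  rw [← neg_sub (Ω ^ 2), neg_div]
  have hsq : ω ^ 2 ≤ (Ω - ε) ^ 2 := sq_le_sq' (by linarith) hω₂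
  have hdiff : (ω - b) ^ 2 ≤ (2 * Ω) ^ 2 := sq_le_sq' (by linarith) (by linarith)
  have hnum : 0 ≤ Ω ^ 2 - ω ^ 2 := by nlinarith
  gcongr

theorem V_tendstoUniformly_one_lowband
    (Ω : ℝ) (hΩ : 0 < Ω) (n : ℕ) (hn : 1 ≤ n)
    (a b : Fin n → ℝ) (ha : ∀ m, 0 < a m) (hb : ∀ m, |b m| < Ω)
    (α : Fin n → ℝ) (hα : ∀ m, α m = (Ω ^ 2 - b m ^ 2) / a m)
    (V : ℝ → ℂ → ℂ)
    (hV : ∀ (γ : ℝ) (p : ℂ), V γ p =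
      ∏ m, (1 - Complex.exp ((γ : ℂ) *
        ((p - a m + Complex.I * b m) / (p + α m - Complex.I * b m)))))
    (ε : ℝ) (hε : ε ∈ Set.Ioo 0 Ω) :
    TendstoUniformlyOn (fun (γ : ℝ) (ω : ℝ) => V γ (Complex.I * ω))
      (fun _ => 1) atTop (Set.Icc (-Ω + ε) (Ω - ε)) := by
  obtain ⟨hε₀, hεΩ⟩ := hε
  have hα₀ : ∀ m, 0 < α m := fun m => by
    rw [hα]
    exact div_pos (sub_pos.mpr (sq_lt_sq.mpr (by rw [abs_of_pos hΩ]; exact hb m))) (ha m)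
  have haα : ∀ m, a m * α m = Ω ^ 2 - b m ^ 2 := fun m => by
    rw [hα, mul_div_cancel₀ _ (ha m).ne']
  set c : Fin n → ℝ := fun m => (Ω ^ 2 - (Ω - ε) ^ 2) / (α m ^ 2 + (2 * Ω) ^ 2) with hc
  have hc₀ : ∀ m, 0 < c m := fun m => div_pos (by nlinarith) (by positivity)
  have hlim : Tendsto (fun γ : ℝ => Real.exp (∑ m, Real.exp (-(γ * c m))) - 1) atTop (nhds 0) := by
    have hsum : Tendsto (fun γ : ℝ => ∑ m, Real.exp (-(γ * c m))) atTop (nhds 0) := by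
      simpa using tendsto_finsetSum Finset.univ fun m _ =>
        Real.tendsto_exp_neg_atTop_nhds_zero.comp (tendsto_id.atTop_mul_const (hc₀ m))
    simpa using ((Real.continuous_exp.tendsto 0).comp hsum).sub_const 1
  rw [Metric.tendstoUniformlyOn_iff]
  intro δ hδ
  filter_upwards [hlim.eventually_lt_const hδ, eventually_ge_atTop 0] with γ hγδ hγ ω hω
  rw [dist_comm, dist_eq_norm, hV]
  simp only [sub_eq_add_neg (1 : ℂ)]
  refine (Finset.norm_prod_one_add_sub_one_le _ _).trans_lt (lt_of_le_of_lt ?_ hγδ)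
  gcongr with m
  rw [norm_neg]
  exact norm_exp_exponent_le hε₀ hεΩ (hb m) (hα₀ m) (haα m) hγ hω
end

section
/- For every ε > 0, the supremum over ω ∈ ℝ with |ω| ≥ Ω+ε of |V_γ(iω) − 1| tends to 0 as γ → −∞; that is, V_γ(iω) → 1 uniformly on {ω : |ω| ≥ Ω+ε} as γ → −∞. -/
open Complex Filter

lemma re_highband_exponent_ge {Ω ε a b ω : ℝ} (hΩ : 0 < Ω) (hε : 0 < ε) (ha : 0 < a)
    (hb : |b| < Ω) (hω : Ω + ε ≤ |ω|) :
    ((Ω + ε) ^ 2 - Ω ^ 2) / (((Ω ^ 2 - b ^ 2) / a) ^ 2 + 4 * (Ω + ε) ^ 2) ≤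
      ((Complex.I * ω - a + Complex.I * b) /
        (Complex.I * ω + ((Ω ^ 2 - b ^ 2) / a : ℝ) - Complex.I * b)).re := by
  obtain ⟨α, hα⟩ : ∃ α, α = (Ω ^ 2 - b ^ 2) / a := ⟨_, rfl⟩
  rw [← hα]
  have haα : a * α = Ω ^ 2 - b ^ 2 := by rw [hα]; field_simp
  have hbΩ : b ^ 2 < Ω ^ 2 := sq_lt_sq' (abs_lt.1 hb).1 (abs_lt.1 hb).2
  have hα_pos : 0 < α := hα ▸ div_pos (by linarith) ha
  have hT : (Ω + ε) ^ 2 ≤ ω ^ 2 := by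
    rw [← sq_abs ω]; gcongr
  have hTΩ : Ω ^ 2 ≤ (Ω + ε) ^ 2 := by gcongr; linarith
  have hre : ((Complex.I * ω - a + Complex.I * b) /
      (Complex.I * ω + (α : ℝ) - Complex.I * b)).re =
      (ω ^ 2 - Ω ^ 2) / (α ^ 2 + (ω - b) ^ 2) := by
    simp only [Complex.div_re, Complex.normSq_apply]
    simp
    rw [← add_div]
    congr 1
    · linear_combination -haα
    · ring
  rw [hre, div_le_div_iff₀ (by positivity) (by positivity)]
  have hden : α ^ 2 + (ω - b) ^ 2 ≤ α ^ 2 + 4 * ω ^ 2 := by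
    nlinarith [sq_nonneg (ω + b)]
  calc ((Ω + ε) ^ 2 - Ω ^ 2) * (α ^ 2 + (ω - b) ^ 2)
      ≤ ((Ω + ε) ^ 2 - Ω ^ 2) * (α ^ 2 + 4 * ω ^ 2) :=
        mul_le_mul_of_nonneg_left hden (by linarith)
    _ ≤ (ω ^ 2 - Ω ^ 2) * (α ^ 2 + 4 * (Ω + ε) ^ 2) := by
        nlinarith [mul_nonneg (add_nonneg (sq_nonneg α) (mul_nonneg zero_le_four (sq_nonneg Ω)))
          (sub_nonneg.2 hT)]

theorem V_tendstoUniformly_one_highband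
    (Ω : ℝ) (hΩ : 0 < Ω) (n : ℕ) (hn : 1 ≤ n)
    (a b : Fin n → ℝ) (ha : ∀ m, 0 < a m) (hb : ∀ m, |b m| < Ω)
    (α : Fin n → ℝ) (hα : ∀ m, α m = (Ω ^ 2 - b m ^ 2) / a m)
    (V : ℝ → ℂ → ℂ)
    (hV : ∀ (γ : ℝ) (p : ℂ), V γ p =
      ∏ m, (1 - Complex.exp ((γ : ℂ) *
        ((p - a m + Complex.I * b m) / (p + α m - Complex.I * b m)))))
    (ε : ℝ) (hε : 0 < ε) :
    TendstoUniformlyOn (fun (γ : ℝ) (ω : ℝ) => V γ (Complex.I * ω))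
      (fun _ => 1) atBot {ω : ℝ | Ω + ε ≤ |ω|} := by
  set c : Fin n → ℝ := fun m ↦
    ((Ω + ε) ^ 2 - Ω ^ 2) / (α m ^ 2 + 4 * (Ω + ε) ^ 2) with hc
  have hc_pos (m : Fin n) : 0 < c m :=
    div_pos (by nlinarith [mul_pos hΩ hε]) (by positivity)
  have hlim : Tendsto (fun γ : ℝ ↦ Real.exp (∑ m, Real.exp (γ * c m)) - 1) atBot (nhds 0) := by
    have hsum : Tendsto (fun γ : ℝ ↦ ∑ m, Real.exp (γ * c m)) atBot (nhds 0) := by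
      simpa using tendsto_finsetSum Finset.univ fun m _ ↦
        Real.tendsto_exp_atBot.comp (tendsto_id.atBot_mul_const (hc_pos m))
    simpa using ((Real.continuous_exp.tendsto 0).comp hsum).sub_const 1
  rw [Metric.tendstoUniformlyOn_iff]
  intro δ hδ
  filter_upwards [hlim.eventually_lt_const hδ, eventually_le_atBot 0] with γ hγδ hγ ω hω
  rw [dist_comm, dist_eq_norm, hV]
  refine lt_of_le_of_lt ?_ hγδ
  simp only [sub_eq_add_neg (1 : ℂ)]
  refine (Finset.norm_prod_one_add_sub_one_le _ _).trans ?_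
  gcongr with m
  rw [norm_neg, Complex.norm_exp, Complex.re_ofReal_mul]
  refine Real.exp_le_exp.2 (mul_le_mul_of_nonpos_left ?_ hγ)
  simpa only [hc, hα] using re_highband_exponent_ge hΩ hε (ha m) (hb m) hω
end

section
/- Let d be a complex polynomial of degree < n. The function p ↦ d(p)·V_γ(p)/∏_{m=1}^n (p − a_m + i·b_m), initially defined on the right half-plane away from the points a_m − i·b_m, extends to a holomorphic function F on all of {p ∈ ℂ : Re p > 0} (each singularity at p = a_m − i·b_m is removable because V_γ vanishes there), F is bounded on {Re p > 0}, and sup over s > 0 of ∫_ℝ |F(s + iω)|² dω is finite. In other words, d·V_γ/δ belongs to H² ∩ H^∞ of the right half-plane, where δ(p) = ∏_{m=1}^n (p − a_m + i·b_m). -/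
open Complex Filter MeasureTheory
open scoped ENNReal

/-- A polynomial of degree less than `n` grows at most like `(1 + ‖p‖) ^ (n - 1)`. -/
lemma exists_one_add_norm_mul_norm_eval_le {n : ℕ} {d : Polynomial ℂ} (hd : d.natDegree < n) :
    ∃ D : ℝ, 0 ≤ D ∧ ∀ p : ℂ, (1 + ‖p‖) * ‖d.eval p‖ ≤ D * (1 + ‖p‖) ^ n := by
  refine ⟨∑ i ∈ Finset.range n, ‖d.coeff i‖, by positivity, fun p => ?_⟩
  have hp := norm_nonneg p
  rw [Polynomial.eval_eq_sum_range' hd, Finset.sum_mul]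
  calc (1 + ‖p‖) * ‖∑ i ∈ Finset.range n, d.coeff i * p ^ i‖
      ≤ (1 + ‖p‖) * ∑ i ∈ Finset.range n, ‖d.coeff i * p ^ i‖ := by
        gcongr
        exact norm_sum_le _ _
    _ ≤ ∑ i ∈ Finset.range n, ‖d.coeff i‖ * (1 + ‖p‖) ^ n := by
        rw [Finset.mul_sum]
        refine Finset.sum_le_sum fun i hi => ?_
        have h1 : ‖p‖ ^ i ≤ (1 + ‖p‖) ^ i := by gcongr; linarith
        have h2 : (1 + ‖p‖) ^ (i + 1) ≤ (1 + ‖p‖) ^ n :=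
          pow_le_pow_right₀ (by linarith) (Finset.mem_range.mp hi)
        rw [norm_mul, norm_pow]
        calc (1 + ‖p‖) * (‖d.coeff i‖ * ‖p‖ ^ i)
            = ‖d.coeff i‖ * (‖p‖ ^ i * (1 + ‖p‖)) := by ring
          _ ≤ ‖d.coeff i‖ * ((1 + ‖p‖) ^ i * (1 + ‖p‖)) := by gcongr
          _ ≤ ‖d.coeff i‖ * (1 + ‖p‖) ^ n := by
            rw [← pow_succ]
            gcongr

lemma add_ne_zero_of_re_pos {p w : ℂ} (hp : 0 < p.re) (hw : 0 < w.re) : p + w ≠ 0 := by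
  intro h
  have := congrArg Complex.re h
  simp only [add_re, zero_re] at this
  linarith

/-- Quotient of `1 - exp (c (p - z) / (p + w))` by `p - z`: it extends holomorphically to the right
half-plane and decays like `1 / (1 + ‖p‖)` there. -/
lemma exists_differentiableOn_one_sub_exp_div (c z w : ℂ) (hw : 0 < w.re) :
    ∃ G : ℂ → ℂ, DifferentiableOn ℂ G {p : ℂ | 0 < p.re} ∧
      (∀ p : ℂ, 0 < p.re → p ≠ z → G p = (1 - exp (c * ((p - z) / (p + w)))) / (p - z)) ∧
      ∃ K : ℝ, 0 ≤ K ∧ ∀ p : ℂ, 0 < p.re → (1 + ‖p‖) * ‖G p‖ ≤ K := by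
  have hE : Differentiable ℂ (dslope exp 0) := by
    rw [← differentiableOn_univ, Complex.differentiableOn_dslope univ_mem]
    exact differentiable_exp.differentiableOn
  have hmul : ∀ x : ℂ, x * dslope exp 0 x = exp x - 1 := fun x => by
    simpa using sub_smul_dslope exp 0 x
  have hlow : ∀ p : ℂ, 0 < p.re → w.re ≤ ‖p + w‖ := fun p hp =>
    le_trans (by simpa using hp.le) (re_le_norm (p + w))
  obtain ⟨B, hB⟩ := (isCompact_closedBall (0 : ℂ) (‖c‖ * (1 + ‖z + w‖ / w.re))).exists_bound_of_continuousOn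
    hE.continuous.continuousOn
  refine ⟨fun p => -c * dslope exp 0 (c * ((p - z) / (p + w))) / (p + w), ?_, ?_, ?_⟩
  · intro p hp
    have hne := add_ne_zero_of_re_pos hp hw
    refine DifferentiableAt.differentiableWithinAt ?_
    have hin : DifferentiableAt ℂ (fun p : ℂ => c * ((p - z) / (p + w))) p := by
      fun_prop (disch := assumption)
    have hcomp := (hE (c * ((p - z) / (p + w)))).fun_comp' p hin
    exact (hcomp.const_mul (-c)).div (by fun_prop) hne
  · intro p hp hpz
    have hne := add_ne_zero_of_re_pos hp hw
    have hpz' := sub_ne_zero.mpr hpz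
    rw [eq_div_iff hpz', ← neg_sub (exp _), ← hmul]
    ring
  · have hB0 : 0 ≤ B := (norm_nonneg _).trans (hB 0 (by simp; positivity))
    refine ⟨(1 + (1 + ‖w‖) / w.re) * (‖c‖ * B), by positivity, fun p hp => ?_⟩
    have hne := add_ne_zero_of_re_pos hp hw
    have hl := hlow p hp
    have hpos : 0 < ‖p + w‖ := norm_pos_iff.mpr hne
    have hmem : c * ((p - z) / (p + w)) ∈ Metric.closedBall (0 : ℂ) (‖c‖ * (1 + ‖z + w‖ / w.re)) := by
      rw [mem_closedBall_zero_iff, norm_mul]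
      have : (p - z) / (p + w) = 1 - (z + w) / (p + w) := by field_simp; ring
      rw [this]
      gcongr
      refine (norm_sub_le _ _).trans ?_
      rw [norm_one, norm_div]
      gcongr
    have hgrow : 1 + ‖p‖ ≤ (1 + (1 + ‖w‖) / w.re) * ‖p + w‖ := by
      have h1 : ‖p‖ ≤ ‖p + w‖ + ‖w‖ := by simpa using norm_sub_le (p + w) w
      have h2 : 1 + ‖w‖ ≤ (1 + ‖w‖) / w.re * ‖p + w‖ := by
        rw [div_mul_eq_mul_div, le_div_iff₀ hw]
        gcongr
      linarith
    rw [norm_div, norm_mul, norm_neg, ← mul_div_assoc, div_le_iff₀ hpos]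
    calc (1 + ‖p‖) * (‖c‖ * ‖dslope exp 0 (c * ((p - z) / (p + w)))‖)
        ≤ ((1 + (1 + ‖w‖) / w.re) * ‖p + w‖) * (‖c‖ * B) := by
          gcongr
          exact hB _ hmem
      _ = _ := by ring

/-- A function on the right half-plane decaying like `1 / (1 + ‖p‖)` is uniformly square integrable
on vertical lines. -/
lemma exists_lintegral_norm_sq_le {F : ℂ → ℂ} {C : ℝ}
    (hF : ∀ p : ℂ, 0 < p.re → (1 + ‖p‖) * ‖F p‖ ≤ C) :
    ∃ M : ℝ≥0∞, M ≠ ⊤ ∧ ∀ s : ℝ, 0 < s →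
      (∫⁻ ω : ℝ, (‖F (s + Complex.I * ω)‖₊ : ℝ≥0∞) ^ 2) ≤ M := by
  refine ⟨∫⁻ ω : ℝ, ENNReal.ofReal (C ^ 2 * (1 + ω ^ 2)⁻¹), ?_, fun s hs => ?_⟩
  · exact (integrable_inv_one_add_sq.const_mul (C ^ 2)).lintegral_lt_top.ne
  · refine lintegral_mono fun ω => ?_
    set p : ℂ := s + I * ω with hp
    have hre : p.re = s := by simp [hp]
    have him : p.im = ω := by simp [hp]
    have h := hF p (by rw [hre]; exact hs)
    have hω : |ω| ≤ ‖p‖ := him ▸ abs_im_le_norm p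
    have h1 : 1 + ω ^ 2 ≤ (1 + ‖p‖) ^ 2 := by
      nlinarith [sq_abs ω, abs_nonneg ω]
    rw [← ENNReal.ofReal_coe_nnreal, coe_nnnorm, ← ENNReal.ofReal_pow (norm_nonneg _)]
    refine ENNReal.ofReal_le_ofReal ?_
    rw [← div_eq_mul_inv, le_div_iff₀ (by positivity)]
    calc ‖F p‖ ^ 2 * (1 + ω ^ 2) ≤ ‖F p‖ ^ 2 * (1 + ‖p‖) ^ 2 := by gcongr
      _ = ((1 + ‖p‖) * ‖F p‖) ^ 2 := by ring
      _ ≤ C ^ 2 := by gcongr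

theorem dV_over_delta_mem_H2_and_Hinfty
    (Ω : ℝ) (hΩ : 0 < Ω) (n : ℕ) (hn : 1 ≤ n)
    (a b : Fin n → ℝ) (ha : ∀ m, 0 < a m) (hb : ∀ m, |b m| < Ω)
    (α : Fin n → ℝ) (hα : ∀ m, α m = (Ω ^ 2 - b m ^ 2) / a m)
    (V : ℝ → ℂ → ℂ)
    (hV : ∀ (γ : ℝ) (p : ℂ), V γ p =
      ∏ m, (1 - Complex.exp ((γ : ℂ) *
        ((p - a m + Complex.I * b m) / (p + α m - Complex.I * b m)))))
    (γ : ℝ) (d : Polynomial ℂ) (hd : d.degree < (n : ℕ)) :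
    ∃ F : ℂ → ℂ,
      DifferentiableOn ℂ F {p : ℂ | 0 < p.re} ∧
      (∀ p : ℂ, 0 < p.re → (∀ m, p ≠ (a m : ℂ) - Complex.I * b m) →
        F p = d.eval p * V γ p / ∏ m, (p - a m + Complex.I * b m)) ∧
      (∃ C : ℝ, ∀ p : ℂ, 0 < p.re → ‖F p‖ ≤ C) ∧
      (∃ M : ℝ≥0∞, M ≠ ⊤ ∧ ∀ s : ℝ, 0 < s →
        (∫⁻ ω : ℝ, (‖F (s + Complex.I * ω)‖₊ : ℝ≥0∞) ^ 2) ≤ M) := by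
  have hdn : d.natDegree < n := by
    rcases eq_or_ne d 0 with rfl | h0
    · rwa [Polynomial.natDegree_zero]
    · exact (Polynomial.natDegree_lt_iff_degree_lt h0).mpr hd
  have hαpos : ∀ m, 0 < α m := fun m => by
    rw [hα]
    exact div_pos (sub_pos.mpr (sq_lt_sq.mpr ((hb m).trans_le (le_abs_self Ω)))) (ha m)
  choose G hGd hGeq K hK0 hGK using fun m =>
    exists_differentiableOn_one_sub_exp_div (γ : ℂ) ((a m : ℂ) - I * b m) ((α m : ℂ) - I * b m)
      (by simpa using hαpos m)
  obtain ⟨D, hD0, hD⟩ := exists_one_add_norm_mul_norm_eval_le hdn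
  have hdecay : ∀ p : ℂ, 0 < p.re →
      (1 + ‖p‖) * ‖d.eval p * ∏ m, G m p‖ ≤ D * ∏ m, K m := fun p hp => by
    calc (1 + ‖p‖) * ‖d.eval p * ∏ m, G m p‖
        = ((1 + ‖p‖) * ‖d.eval p‖) * ∏ m, ‖G m p‖ := by
          rw [norm_mul, norm_prod, mul_assoc]
      _ ≤ (D * (1 + ‖p‖) ^ n) * ∏ m, ‖G m p‖ := by
          exact mul_le_mul_of_nonneg_right (hD p) (by positivity)
      _ = D * ∏ m, ((1 + ‖p‖) * ‖G m p‖) := by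
          rw [Finset.prod_mul_distrib, Finset.prod_const, Finset.card_univ, Fintype.card_fin,
            mul_assoc]
      _ ≤ D * ∏ m, K m := by
          refine mul_le_mul_of_nonneg_left ?_ hD0
          exact Finset.prod_le_prod (fun m _ => by positivity) fun m _ => hGK m p hp
  have hlint := exists_lintegral_norm_sq_le (F := fun p => d.eval p * ∏ m, G m p) hdecay
  refine ⟨fun p => d.eval p * ∏ m, G m p, ?_, ?_, ⟨D * ∏ m, K m, ?_⟩, hlint⟩
  · exact d.differentiable.differentiableOn.mul
      (DifferentiableOn.fun_finsetProd fun m _ => hGd m)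
  · intro p hp hne
    simp only [hV]
    rw [mul_div_assoc, ← Finset.prod_div_distrib]
    refine congrArg _ (Finset.prod_congr rfl fun m _ => ?_)
    rw [hGeq m p hp (hne m), sub_add, add_sub_assoc]
  · intro p hp
    refine le_trans ?_ (hdecay p hp)
    exact le_mul_of_one_le_left (norm_nonneg _) (le_add_of_nonneg_right (norm_nonneg _))
end

section
/- Fix ε ∈ (0, Ω). For every η > 0 there exists γ₀ ∈ ℝ such that for every γ ≥ γ₀ the following holds: for every sequence (c_k) of complex numbers with ∑_k |c_k| < ∞, every sequence (ω_k) of reals with |ω_k| ≤ Ω − ε for all k, and every X_c ∈ L¹(ℝ, ℂ) supported in [−Ω+ε, Ω−ε], the functions y(t) = (1/(2π))·(∑_k c_k K(iω_k) e^{i ω_k t} + ∫_ℝ e^{iωt} K(iω) X_c(ω) dω) and ŷ_γ(t) = (1/(2π))·(∑_k c_k V_γ(iω_k) K(iω_k) e^{i ω_k t} + ∫_ℝ e^{iωt} V_γ(iω) K(iω) X_c(ω) dω) satisfy sup over t ∈ ℝ of |ŷ_γ(t) − y(t)| ≤ η · (∑_k |c_k| + ‖X_c‖_{L¹(ℝ)}).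 -/
open Complex Filter MeasureTheory Real
open scoped ENNReal

/-- The quotient in the exponent of the predictor has negative real part at `iω` for `|ω| < Ω`. -/
lemma re_exponent_neg {Ω a b α ω : ℝ} (hα : 0 < α) (hαa : α * a = Ω ^ 2 - b ^ 2)
    (hω : |ω| < Ω) :
    ((I * ω - a + I * b) / (I * ω + α - I * b) : ℂ).re < 0 := by
  have hsq : ω ^ 2 < Ω ^ 2 := sq_lt_sq' (abs_lt.1 hω).1 (abs_lt.1 hω).2
  have hN : 0 < α * α + (ω - b) * (ω - b) :=
    add_pos_of_pos_of_nonneg (mul_pos hα hα) (mul_self_nonneg _)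
  have hre : ((I * ω - a + I * b) / (I * ω + α - I * b) : ℂ).re =
      (ω ^ 2 - Ω ^ 2) / (α * α + (ω - b) * (ω - b)) := by
    rw [Complex.div_re, ← add_div]
    simp only [Complex.normSq_apply, Complex.add_re, Complex.sub_re, Complex.mul_re, Complex.I_re,
      Complex.ofReal_re, Complex.I_im, Complex.ofReal_im, Complex.add_im, Complex.sub_im,
      Complex.mul_im]
    congr 1
    · linear_combination -hαa
    · ring
  rw [hre]
  exact div_neg_of_neg_of_pos (by linarith) hN

lemma I_mul_add_ne_zero {x c : ℝ} (b : ℝ) (hc : c ≠ 0) : (I * x + c + I * b : ℂ) ≠ 0 := by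
  intro h
  apply hc
  simpa using congrArg Complex.re h

/-- A product `∏ (1 - exp (γ q_m))` tends to `1` as `γ → ∞`, uniformly on a compact set on which
all the `q_m` have negative real part. -/
lemma exists_forall_norm_prod_one_sub_exp_sub_one_le {ι : Type*} [Fintype ι] {S : Set ℝ}
    (hS : IsCompact S) {q : ι → ℝ → ℂ} (hq : ∀ m, Continuous (q m))
    (hneg : ∀ m, ∀ ω ∈ S, (q m ω).re < 0) {η : ℝ} (hη : 0 < η) :
    ∃ γ₀ : ℝ, ∀ γ ≥ γ₀, ∀ ω ∈ S, ‖∏ m, (1 - Complex.exp (γ * q m ω)) - 1‖ ≤ η := by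
  have hδ : ∀ m, ∃ δ : ℝ, 0 < δ ∧ ∀ ω ∈ S, δ ≤ -(q m ω).re := fun m =>
    hS.exists_forall_le' (f := fun ω => -(q m ω).re)
      (Complex.continuous_re.comp (hq m)).neg.continuousOn
      fun ω hω => neg_pos.2 (hneg m ω hω)
  choose δ hδ0 hδ using hδ
  have hlim : Tendsto (fun γ : ℝ => Real.exp (∑ m, Real.exp (-(γ * δ m))) - 1) atTop (nhds 0) := by
    have h : Tendsto (fun γ : ℝ => ∑ m, Real.exp (-(γ * δ m))) atTop (nhds (∑ _m : ι, 0)) :=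
      tendsto_finsetSum _ fun m _ =>
        Real.tendsto_exp_neg_atTop_nhds_zero.comp (tendsto_id.atTop_mul_const (hδ0 m))
    simpa using ((Real.continuous_exp.tendsto _).comp h).sub_const 1
  obtain ⟨γ₁, hγ₁⟩ := eventually_atTop.1 (hlim.eventually_le_const hη)
  refine ⟨max γ₁ 0, fun γ hγ ω hω => ?_⟩
  have hγ0 : 0 ≤ γ := (le_max_right _ _).trans hγ
  calc ‖∏ m, (1 - Complex.exp (γ * q m ω)) - 1‖
      = ‖∏ m, (1 + -Complex.exp (γ * q m ω)) - 1‖ := by simp only [sub_eq_add_neg]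
    _ ≤ Real.exp (∑ m, ‖-Complex.exp (γ * q m ω)‖) - 1 :=
        Finset.univ.norm_prod_one_add_sub_one_le _
    _ ≤ Real.exp (∑ m, Real.exp (-(γ * δ m))) - 1 := by
        gcongr with m
        rw [norm_neg, Complex.norm_exp, Complex.re_ofReal_mul]
        gcongr
        have := mul_le_mul_of_nonneg_left (hδ m ω hω) hγ0
        linarith
    _ ≤ η := hγ₁ γ ((le_max_left _ _).trans hγ)

lemma norm_exp_I_mul_ofReal_mul_ofReal (x t : ℝ) : ‖Complex.exp (I * x * t)‖ = 1 := by
  rw [mul_assoc, ← Complex.ofReal_mul, Complex.norm_exp_I_mul_ofReal]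

lemma summable_trigonometric {S : Set ℝ} (hS : IsCompact S) {F : ℝ → ℂ} (hF : Continuous F)
    {c : ℕ → ℂ} {ωs : ℕ → ℝ} (hc : Summable fun k => ‖c k‖) (hωs : ∀ k, ωs k ∈ S) (t : ℝ) :
    Summable fun k => c k * F (ωs k) * Complex.exp (I * ωs k * t) := by
  obtain ⟨M, hM⟩ := hS.exists_bound_of_continuousOn hF.continuousOn
  refine Summable.of_norm_bounded (hc.mul_right M) fun k => ?_
  rw [norm_mul, norm_mul, norm_exp_I_mul_ofReal_mul_ofReal, mul_one]
  gcongr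
  exact hM _ (hωs k)

lemma integrable_trigonometric {S : Set ℝ} (hS : IsCompact S) {F : ℝ → ℂ} (hF : Continuous F)
    {X : ℝ → ℂ} (hX : Integrable X volume) (hXS : ∀ ω, X ω ≠ 0 → ω ∈ S) (t : ℝ) :
    Integrable (fun ω : ℝ => Complex.exp (I * ω * t) * F ω * X ω) volume := by
  obtain ⟨M, hM⟩ := hS.exists_bound_of_continuousOn hF.continuousOn
  have hcont : Continuous fun ω : ℝ => Complex.exp (I * ω * t) * F ω := by fun_prop
  refine Integrable.mono' (hX.norm.const_mul M)
    (hcont.aestronglyMeasurable.mul hX.aestronglyMeasurable) (Eventually.of_forall fun ω => ?_)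
  rw [norm_mul, norm_mul, norm_exp_I_mul_ofReal_mul_ofReal, one_mul]
  by_cases h : X ω = 0
  · simp [h]
  · gcongr
    exact hM _ (hXS ω h)

/-- Two transfer functions that are `η`-close on a compact set produce `η`-close outputs on inputs
with spectrum in that set. -/
lemma norm_output_sub_output_le {S : Set ℝ} (hS : IsCompact S) {F G : ℝ → ℂ} (hF : Continuous F)
    (hG : Continuous G) {η : ℝ} (hFG : ∀ ω ∈ S, ‖F ω - G ω‖ ≤ η)
    {c : ℕ → ℂ} {ωs : ℕ → ℝ} {X : ℝ → ℂ} (hc : Summable fun k => ‖c k‖) (hωs : ∀ k, ωs k ∈ S)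
    (hX : Integrable X volume) (hXS : ∀ ω, X ω ≠ 0 → ω ∈ S) (t : ℝ) :
    ‖((∑' k, c k * F (ωs k) * Complex.exp (I * ωs k * t)) +
          ∫ ω : ℝ, Complex.exp (I * ω * t) * F ω * X ω) -
        ((∑' k, c k * G (ωs k) * Complex.exp (I * ωs k * t)) +
          ∫ ω : ℝ, Complex.exp (I * ω * t) * G ω * X ω)‖
      ≤ η * ((∑' k, ‖c k‖) + ∫ ω : ℝ, ‖X ω‖) := by
  rw [add_sub_add_comm, ← (summable_trigonometric hS hF hc hωs t).tsum_sub
      (summable_trigonometric hS hG hc hωs t),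
    ← integral_sub (integrable_trigonometric hS hF hX hXS t)
      (integrable_trigonometric hS hG hX hXS t), mul_add, ← tsum_mul_left, ← integral_const_mul]
  refine (norm_add_le _ _).trans (add_le_add ?_ ?_)
  · refine tsum_of_norm_bounded (hc.mul_left η).hasSum fun k => ?_
    rw [← sub_mul, ← mul_sub, norm_mul, norm_mul, norm_exp_I_mul_ofReal_mul_ofReal, mul_one,
      mul_comm]
    gcongr
    exact hFG _ (hωs k)
  · refine norm_integral_le_of_norm_le (hX.norm.const_mul η) (Eventually.of_forall fun ω => ?_)
    rw [← sub_mul, ← mul_sub, norm_mul, norm_mul, norm_exp_I_mul_ofReal_mul_ofReal, one_mul]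
    by_cases h : X ω = 0
    · simp [h]
    · gcongr
      exact hFG _ (hXS ω h)

theorem Linfty_uniform_prediction_ML
    (Ω : ℝ) (hΩ : 0 < Ω) (n : ℕ) (hn : 1 ≤ n)
    (a b : Fin n → ℝ) (ha : ∀ m, 0 < a m) (hb : ∀ m, |b m| < Ω)
    (α : Fin n → ℝ) (hα : ∀ m, α m = (Ω ^ 2 - b m ^ 2) / a m)
    (V : ℝ → ℂ → ℂ)
    (hV : ∀ (γ : ℝ) (p : ℂ), V γ p =
      ∏ m, (1 - Complex.exp ((γ : ℂ) *
        ((p - a m + Complex.I * b m) / (p + α m - Complex.I * b m)))))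
    (d : Polynomial ℂ) (hd : d.degree < (n : ℕ))
    (K : ℝ → ℂ) (hK : ∀ ω : ℝ, K ω =
      d.eval (Complex.I * ω) / ∏ m, (Complex.I * ω - a m + Complex.I * b m))
    (ε : ℝ) (hε : ε ∈ Set.Ioo 0 Ω) :
    ∀ η > (0 : ℝ), ∃ γ₀ : ℝ, ∀ γ ≥ γ₀,
      ∀ (c : ℕ → ℂ) (ωs : ℕ → ℝ) (Xc : ℝ → ℂ),
        Summable (fun k => ‖c k‖) →
        (∀ k, |ωs k| ≤ Ω - ε) →
        Integrable Xc volume →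
        (∀ ω : ℝ, Xc ω ≠ 0 → ω ∈ Set.Icc (-Ω + ε) (Ω - ε)) →
        ∀ t : ℝ,
          ‖((1 / (2 * (Real.pi : ℂ))) *
              ((∑' k, c k * (V γ (Complex.I * ωs k) * K (ωs k)) *
                  Complex.exp (Complex.I * ωs k * t)) +
                ∫ ω : ℝ, Complex.exp (Complex.I * ω * t) *
                  (V γ (Complex.I * ω) * K ω) * Xc ω)) -
            ((1 / (2 * (Real.pi : ℂ))) *
              ((∑' k, c k * K (ωs k) * Complex.exp (Complex.I * ωs k * t)) +
                ∫ ω : ℝ, Complex.exp (Complex.I * ω * t) * K ω * Xc ω))‖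
            ≤ η * ((∑' k, ‖c k‖) + ∫ ω : ℝ, ‖Xc ω‖) := by
  intro η hη
  have hα0 : ∀ m, 0 < α m := fun m => by
    rw [hα]
    exact div_pos (sub_pos.2 (sq_lt_sq' (abs_lt.1 (hb m)).1 (abs_lt.1 (hb m)).2)) (ha m)
  have hq : ∀ m, Continuous fun ω : ℝ =>
      (I * ω - a m + I * b m) / (I * ω + α m - I * b m : ℂ) := fun m =>
    Continuous.div (by fun_prop) (by fun_prop) fun ω => by
      simpa [sub_eq_add_neg] using I_mul_add_ne_zero (x := ω) (-b m) (hα0 m).ne'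
  have hKcont : Continuous K := by
    rw [funext hK]
    refine Continuous.div (d.continuous.comp (by fun_prop)) (by fun_prop) fun ω => ?_
    refine Finset.prod_ne_zero_iff.2 fun m _ => ?_
    simpa [sub_eq_add_neg] using I_mul_add_ne_zero (x := ω) (b m) (neg_ne_zero.2 (ha m).ne')
  have hVcont : ∀ γ, Continuous fun ω : ℝ => V γ (I * ω) := fun γ => by
    simp only [hV]
    exact continuous_finsetProd _ fun m _ =>
      continuous_const.sub (Complex.continuous_exp.comp (continuous_const.mul (hq m)))
  have hS : IsCompact (Set.Icc (-Ω + ε) (Ω - ε)) := isCompact_Icc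
  obtain ⟨M, hM⟩ := hS.exists_bound_of_continuousOn hKcont.continuousOn
  have hM1 : 0 < max M 1 := lt_max_of_lt_right one_pos
  have hneg : ∀ m, ∀ ω ∈ Set.Icc (-Ω + ε) (Ω - ε),
      ((I * ω - a m + I * b m) / (I * ω + α m - I * b m : ℂ)).re < 0 := fun m ω hω =>
    re_exponent_neg (hα0 m) (by rw [hα, div_mul_cancel₀ _ (ha m).ne'])
      (abs_lt.2 ⟨by linarith [hω.1, hε.1], by linarith [hω.2, hε.1]⟩)
  obtain ⟨γ₀, hγ₀⟩ :=
    exists_forall_norm_prod_one_sub_exp_sub_one_le hS hq hneg (div_pos hη hM1)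
  refine ⟨γ₀, fun γ hγ c ωs Xc hc hωs hX hXS t => ?_⟩
  have hclose : ∀ ω ∈ Set.Icc (-Ω + ε) (Ω - ε), ‖V γ (I * ω) * K ω - K ω‖ ≤ η := fun ω hω => by
    have h1 : ‖V γ (I * ω) - 1‖ ≤ η / max M 1 := by
      rw [hV]
      exact hγ₀ γ hγ ω hω
    calc ‖V γ (I * ω) * K ω - K ω‖ = ‖V γ (I * ω) - 1‖ * ‖K ω‖ := by
          rw [← norm_mul, sub_mul, one_mul]
      _ ≤ η / max M 1 * max M 1 := by
          gcongr
          exact (hM ω hω).trans (le_max_left _ _)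
      _ = η := div_mul_cancel₀ _ hM1.ne'
  have hωs' : ∀ k, ωs k ∈ Set.Icc (-Ω + ε) (Ω - ε) := fun k =>
    ⟨by linarith [(abs_le.1 (hωs k)).1], (abs_le.1 (hωs k)).2⟩
  have hpi : ‖(1 / (2 * (Real.pi : ℂ)))‖ ≤ 1 := by
    rw [norm_div, norm_one, norm_mul, Complex.norm_real, Complex.norm_two, Real.norm_eq_abs,
      abs_of_pos Real.pi_pos]
    exact div_le_one_of_le₀ (by linarith [Real.pi_gt_three]) (by positivity)
  rw [← mul_sub, norm_mul]
  exact (mul_le_of_le_one_left (norm_nonneg _) hpi).trans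
    (norm_output_sub_output_le hS ((hVcont γ).mul hKcont) hKcont hclose hc hωs' hX hXS t)
end

section
/- Fix ε > 0. For every η > 0 there exists γ₀ ∈ ℝ such that for every γ ≤ γ₀ the following holds: for every sequence (c_k) of complex numbers with ∑_k |c_k| < ∞, every sequence (ω_k) of reals with |ω_k| ≥ Ω + ε for all k, and every X_c ∈ L¹(ℝ, ℂ) supported in {ω : |ω| ≥ Ω + ε}, the functions y(t) = (1/(2π))·(∑_k c_k K(iω_k) e^{i ω_k t} + ∫_ℝ e^{iωt} K(iω) X_c(ω) dω) and ŷ_γ(t) = (1/(2π))·(∑_k c_k V_γ(iω_k) K(iω_k) e^{i ω_k t} + ∫_ℝ e^{iωt} V_γ(iω) K(iω) X_c(ω) dω) satisfy sup over t ∈ ℝ of |ŷ_γ(t) − y(t)| ≤ η · (∑_k |c_k| + ‖X_c‖_{L¹(ℝ)}). -/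
open Complex Filter MeasureTheory Real
open scoped ENNReal

/-- Multipliers that are uniformly `η`-close on a set carrying the spectrum produce uniformly
`η`-close outputs. -/
lemma norm_spectral_synthesis_sub_le {S : Set ℝ} {G H : ℝ → ℂ} (hG : Measurable G)
    (hH : Measurable H) {C η : ℝ} (hGC : ∀ ω ∈ S, ‖G ω‖ ≤ C) (hHC : ∀ ω ∈ S, ‖H ω‖ ≤ C)
    (hGH : ∀ ω ∈ S, ‖G ω - H ω‖ ≤ η) {c : ℕ → ℂ} {ωs : ℕ → ℝ} {X : ℝ → ℂ}
    (hc : Summable fun k => ‖c k‖) (hωs : ∀ k, ωs k ∈ S) (hX : Integrable X)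
    (hXS : ∀ ω, X ω ≠ 0 → ω ∈ S) (t : ℝ) :
    ‖((∑' k, c k * G (ωs k) * Complex.exp (I * ωs k * t)) +
          ∫ ω : ℝ, Complex.exp (I * ω * t) * G ω * X ω) -
        ((∑' k, c k * H (ωs k) * Complex.exp (I * ωs k * t)) +
          ∫ ω : ℝ, Complex.exp (I * ω * t) * H ω * X ω)‖
      ≤ η * ((∑' k, ‖c k‖) + ∫ ω : ℝ, ‖X ω‖) := by
  have hexp (ω : ℝ) : ‖Complex.exp (I * ω * t)‖ = 1 := by
    rw [Complex.norm_exp]; simp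
  have hsum {F : ℝ → ℂ} (hF : ∀ ω ∈ S, ‖F ω‖ ≤ C) :
      Summable fun k => c k * F (ωs k) * Complex.exp (I * ωs k * t) := by
    refine .of_norm_bounded (hc.mul_right C) fun k => ?_
    rw [norm_mul, norm_mul, hexp, mul_one]
    exact mul_le_mul_of_nonneg_left (hF _ (hωs k)) (norm_nonneg _)
  have hpt {F : ℝ → ℂ} {D : ℝ} (hF : ∀ ω ∈ S, ‖F ω‖ ≤ D) (ω : ℝ) :
      ‖Complex.exp (I * ω * t) * F ω * X ω‖ ≤ D * ‖X ω‖ := by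
    by_cases h : X ω = 0
    · simp [h]
    · rw [norm_mul, norm_mul, hexp, one_mul]
      exact mul_le_mul_of_nonneg_right (hF ω (hXS ω h)) (norm_nonneg _)
  have hint {F : ℝ → ℂ} (hm : Measurable F) (hF : ∀ ω ∈ S, ‖F ω‖ ≤ C) :
      Integrable fun ω : ℝ => Complex.exp (I * ω * t) * F ω * X ω := by
    refine (hX.norm.const_mul C).mono' (.mul ?_ hX.aestronglyMeasurable) (.of_forall (hpt hF))
    exact Measurable.aestronglyMeasurable (by fun_prop)
  rw [add_sub_add_comm, ← (hsum hGC).tsum_sub (hsum hHC),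
    ← integral_sub (hint hG hGC) (hint hH hHC), mul_add]
  refine (norm_add_le _ _).trans (add_le_add ?_ ?_)
  · rw [← tsum_mul_left]
    refine tsum_of_norm_bounded (hc.mul_left η).hasSum fun k => ?_
    rw [← sub_mul, ← mul_sub, norm_mul, norm_mul, hexp, mul_one, mul_comm]
    exact mul_le_mul_of_nonneg_right (hGH _ (hωs k)) (norm_nonneg _)
  · rw [← integral_const_mul]
    refine norm_integral_le_of_norm_le (hX.norm.const_mul η) (.of_forall fun ω => ?_)
    rw [← sub_mul, ← mul_sub]
    exact hpt (F := G - H) hGH ω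

lemma Polynomial.exists_norm_eval_le_mul_one_add_pow (d : Polynomial ℂ) {n : ℕ}
    (hd : d.natDegree ≤ n) : ∃ C, 0 ≤ C ∧ ∀ z : ℂ, ‖d.eval z‖ ≤ C * (1 + ‖z‖) ^ n := by
  refine ⟨∑ i ∈ Finset.range (d.natDegree + 1), ‖d.coeff i‖, by positivity, fun z => ?_⟩
  rw [Polynomial.eval_eq_sum_range, Finset.sum_mul]
  refine (norm_sum_le _ _).trans (Finset.sum_le_sum fun i hi => ?_)
  rw [norm_mul, norm_pow]
  have hz := norm_nonneg z
  have hin : i ≤ n := (Nat.lt_succ_iff.mp (Finset.mem_range.mp hi)).trans hd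
  gcongr
  calc ‖z‖ ^ i ≤ (1 + ‖z‖) ^ i := by gcongr; linarith
    _ ≤ (1 + ‖z‖) ^ n := by gcongr; linarith

lemma I_mul_sub_add_I_mul_ne_zero {a : ℝ} (ha : 0 < a) (b ω : ℝ) :
    (I * ω - a + I * b : ℂ) ≠ 0 := fun h => by
  have := congrArg Complex.re h
  simp at this
  exact ha.ne' this

lemma one_add_abs_le_mul_norm {a : ℝ} (ha : 0 < a) (b ω : ℝ) :
    1 + |ω| ≤ ((1 + |b|) / a + 1) * ‖(I * ω - a + I * b : ℂ)‖ := by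
  have hre := Complex.abs_re_le_norm (I * ω - a + I * b : ℂ)
  have him := Complex.abs_im_le_norm (I * ω - a + I * b : ℂ)
  simp only [add_re, sub_re, mul_re, I_re, I_im, ofReal_re, ofReal_im, add_im, sub_im, mul_im,
    zero_mul, one_mul, mul_zero, sub_zero, zero_sub, zero_add, add_zero, abs_neg,
    abs_of_pos ha] at hre him
  have hω : |ω| ≤ |ω + b| + |b| := by simpa using abs_sub (ω + b) b
  have hdiv : 1 + |b| ≤ (1 + |b|) / a * ‖(I * ω - a + I * b : ℂ)‖ := by
    rw [div_mul_eq_mul_div, le_div_iff₀ ha]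
    gcongr
  linarith

lemma exists_norm_transfer_le {n : ℕ} {a : Fin n → ℝ} (ha : ∀ m, 0 < a m) (b : Fin n → ℝ)
    {d : Polynomial ℂ} (hd : d.natDegree ≤ n) :
    ∃ B, 0 < B ∧ ∀ ω : ℝ, ‖d.eval (I * ω) / ∏ m, (I * ω - a m + I * b m)‖ ≤ B := by
  obtain ⟨C, hC, hCd⟩ := d.exists_norm_eval_le_mul_one_add_pow hd
  have hP : 0 ≤ ∏ m, ((1 + |b m|) / a m + 1) :=
    Finset.prod_nonneg fun m _ => by have := ha m; positivity
  refine ⟨C * (∏ m, ((1 + |b m|) / a m + 1)) + 1, by positivity, fun ω => ?_⟩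
  have hden : 0 < ‖∏ m, (I * ω - a m + I * b m : ℂ)‖ :=
    norm_pos_iff.mpr (Finset.prod_ne_zero_iff.mpr fun m _ =>
      I_mul_sub_add_I_mul_ne_zero (ha m) (b m) ω)
  rw [norm_div, div_le_iff₀ hden]
  have hpow : (1 + |ω|) ^ n ≤
      (∏ m, ((1 + |b m|) / a m + 1)) * ‖∏ m, (I * ω - a m + I * b m : ℂ)‖ := by
    rw [norm_prod, ← Finset.prod_mul_distrib]
    calc (1 + |ω|) ^ n = ∏ _m : Fin n, (1 + |ω|) := by simp
      _ ≤ _ := Finset.prod_le_prod (fun _ _ => by positivity)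
        fun m _ => one_add_abs_le_mul_norm (ha m) (b m) ω
  have hd' : ‖d.eval (I * ω)‖ ≤ C * (1 + |ω|) ^ n := by simpa using hCd (I * ω)
  have := mul_le_mul_of_nonneg_left hpow hC
  linarith

/-- The exponent of the predictor factor has real part bounded away from `0` at high frequency. -/
lemma exists_pos_le_re_div {Ω a b ε : ℝ} (hΩ : 0 < Ω) (ha : 0 < a) (hb : |b| < Ω) (hε : 0 < ε) :
    ∃ δ, 0 < δ ∧ ∀ ω : ℝ, Ω + ε ≤ |ω| →
      δ ≤ ((I * ω - a + I * b) / (I * ω + ((Ω ^ 2 - b ^ 2) / a : ℝ) - I * b) : ℂ).re := by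
  set α := (Ω ^ 2 - b ^ 2) / a with hα
  have hα0 : 0 < α := div_pos (sub_pos.mpr (sq_lt_sq.mpr (by rwa [abs_of_pos hΩ]))) ha
  have haα : a * α = Ω ^ 2 - b ^ 2 := by rw [hα]; field_simp
  refine ⟨ε / (2 * Ω + ε) / (1 + α ^ 2 / Ω ^ 2), by positivity, fun ω hω => ?_⟩
  have hre : ((I * ω - a + I * b) / (I * ω + (α : ℝ) - I * b) : ℂ).re =
      (ω ^ 2 - Ω ^ 2) / (α ^ 2 + (ω - b) ^ 2) := by
    rw [Complex.div_re, ← add_div]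
    simp only [normSq_apply, add_re, sub_re, mul_re, I_re, I_im, ofReal_re, ofReal_im, add_im,
      sub_im, mul_im]
    congr 1
    · linear_combination -haα
    · ring
  have hden : 0 < α ^ 2 + (ω - b) ^ 2 := by positivity
  rw [hre, div_div, div_le_div_iff₀ (by positivity) hden]
  set s := |ω| with hs
  have hs0 : 0 ≤ s := abs_nonneg ω
  have hωs : ω ^ 2 = s ^ 2 := (sq_abs ω).symm
  have hsq : (ω - b) ^ 2 ≤ (s + Ω) ^ 2 := by
    rw [sq_le_sq, abs_of_nonneg (by positivity : 0 ≤ s + Ω)]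
    exact (abs_sub ω b).trans (by linarith)
  have hαs : α ^ 2 ≤ α ^ 2 / Ω ^ 2 * (s + Ω) ^ 2 := by
    rw [div_mul_eq_mul_div, le_div_iff₀ (by positivity)]
    gcongr
    linarith
  have hκ : ε * (s + Ω) ≤ (s - Ω) * (2 * Ω + ε) := by nlinarith
  calc ε * (α ^ 2 + (ω - b) ^ 2)
      ≤ ε * ((1 + α ^ 2 / Ω ^ 2) * (s + Ω) ^ 2) := by gcongr; linarith
    _ = ε * (s + Ω) * ((s + Ω) * (1 + α ^ 2 / Ω ^ 2)) := by ring
    _ ≤ (s - Ω) * (2 * Ω + ε) * ((s + Ω) * (1 + α ^ 2 / Ω ^ 2)) := by gcongr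
    _ = (ω ^ 2 - Ω ^ 2) * ((2 * Ω + ε) * (1 + α ^ 2 / Ω ^ 2)) := by rw [hωs]; ring

lemma norm_prod_one_sub_cexp_sub_one_le {ι : Type*} (s : Finset ι) {δ : ι → ℝ} {q : ι → ℂ}
    (hq : ∀ m ∈ s, δ m ≤ (q m).re) {γ : ℝ} (hγ : γ ≤ 0) :
    ‖∏ m ∈ s, (1 - Complex.exp (γ * q m)) - 1‖ ≤
      Real.exp (∑ m ∈ s, Real.exp (γ * δ m)) - 1 := by
  simp only [sub_eq_add_neg (1 : ℂ)]
  refine (s.norm_prod_one_add_sub_one_le fun m => -Complex.exp (γ * q m)).trans ?_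
  gcongr with m hm
  rw [norm_neg, Complex.norm_exp, Complex.re_ofReal_mul]
  exact Real.exp_le_exp.mpr (mul_le_mul_of_nonpos_left (hq m hm) hγ)

lemma tendsto_exp_sum_exp_sub_one_atBot {ι : Type*} (s : Finset ι) {δ : ι → ℝ}
    (hδ : ∀ m ∈ s, 0 < δ m) :
    Tendsto (fun γ : ℝ => Real.exp (∑ m ∈ s, Real.exp (γ * δ m)) - 1) atBot (nhds 0) := by
  have h : Tendsto (fun γ : ℝ => ∑ m ∈ s, Real.exp (γ * δ m)) atBot (nhds (∑ m ∈ s, 0)) :=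
    tendsto_finsetSum s fun m hm =>
      Real.tendsto_exp_atBot.comp (tendsto_id.atBot_mul_const (hδ m hm))
  simpa using ((Real.continuous_exp.tendsto _).comp h).sub_const 1

theorem Linfty_uniform_prediction_MH
    (Ω : ℝ) (hΩ : 0 < Ω) (n : ℕ) (hn : 1 ≤ n)
    (a b : Fin n → ℝ) (ha : ∀ m, 0 < a m) (hb : ∀ m, |b m| < Ω)
    (α : Fin n → ℝ) (hα : ∀ m, α m = (Ω ^ 2 - b m ^ 2) / a m)
    (V : ℝ → ℂ → ℂ)
    (hV : ∀ (γ : ℝ) (p : ℂ), V γ p =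
      ∏ m, (1 - Complex.exp ((γ : ℂ) *
        ((p - a m + Complex.I * b m) / (p + α m - Complex.I * b m)))))
    (d : Polynomial ℂ) (hd : d.degree < (n : ℕ))
    (K : ℝ → ℂ) (hK : ∀ ω : ℝ, K ω =
      d.eval (Complex.I * ω) / ∏ m, (Complex.I * ω - a m + Complex.I * b m))
    (ε : ℝ) (hε : 0 < ε) :
    ∀ η > (0 : ℝ), ∃ γ₀ : ℝ, ∀ γ ≤ γ₀,
      ∀ (c : ℕ → ℂ) (ωs : ℕ → ℝ) (Xc : ℝ → ℂ),
        Summable (fun k => ‖c k‖) →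
        (∀ k, Ω + ε ≤ |ωs k|) →
        Integrable Xc volume →
        (∀ ω : ℝ, Xc ω ≠ 0 → Ω + ε ≤ |ω|) →
        ∀ t : ℝ,
          ‖((1 / (2 * (Real.pi : ℂ))) *
              ((∑' k, c k * (V γ (Complex.I * ωs k) * K (ωs k)) *
                  Complex.exp (Complex.I * ωs k * t)) +
                ∫ ω : ℝ, Complex.exp (Complex.I * ω * t) *
                  (V γ (Complex.I * ω) * K ω) * Xc ω)) -
            ((1 / (2 * (Real.pi : ℂ))) *
              ((∑' k, c k * K (ωs k) * Complex.exp (Complex.I * ωs k * t)) +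
                ∫ ω : ℝ, Complex.exp (Complex.I * ω * t) * K ω * Xc ω))‖
            ≤ η * ((∑' k, ‖c k‖) + ∫ ω : ℝ, ‖Xc ω‖) := by
  intro η hη
  choose δ hδ0 hδ using fun m => exists_pos_le_re_div hΩ (ha m) (hb m) hε
  obtain ⟨B, hB0, hB⟩ :=
    exists_norm_transfer_le ha b (Polynomial.natDegree_le_of_degree_le hd.le)
  have hKB (ω : ℝ) : ‖K ω‖ ≤ B := by rw [hK]; exact hB ω
  obtain ⟨γ₀, hγ₀⟩ := Filter.eventually_atBot.mp <|
    ((tendsto_exp_sum_exp_sub_one_atBot Finset.univ fun m _ => hδ0 m).eventually_le_const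
      (div_pos hη hB0)).and (Filter.eventually_le_atBot 0)
  refine ⟨γ₀, fun γ hγ c ωs Xc hc hωs hXc hXS t => ?_⟩
  obtain ⟨hγη, hγ0⟩ := hγ₀ γ hγ
  have hVK (ω : ℝ) (hω : Ω + ε ≤ |ω|) : ‖V γ (I * ω) * K ω - K ω‖ ≤ η := by
    have hV1 : ‖V γ (I * ω) - 1‖ ≤ η / B := by
      rw [hV]
      refine (norm_prod_one_sub_cexp_sub_one_le _ (fun m _ => ?_) hγ0).trans hγη
      rw [hα]
      exact hδ m ω hω
    rw [← sub_one_mul, norm_mul]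
    calc ‖V γ (I * ω) - 1‖ * ‖K ω‖ ≤ η / B * B := by gcongr; exact hKB ω
      _ = η := by field_simp
  have hKm : Measurable K := by
    rw [funext hK]
    exact (by fun_prop : Measurable fun ω : ℝ => d.eval (I * ω)).div (by fun_prop)
  have hVm : Measurable fun ω : ℝ => V γ (I * ω) := by
    simp only [hV]
    fun_prop
  have key := norm_spectral_synthesis_sub_le (S := {ω | Ω + ε ≤ |ω|}) (C := η + B)
    (hVm.mul hKm) hKm
    (fun ω hω => by
      have := norm_add_le (V γ (I * ω) * K ω - K ω) (K ω)
      rw [sub_add_cancel] at this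
      exact this.trans (add_le_add (hVK ω hω) (hKB ω)))
    (fun ω _ => (hKB ω).trans (by linarith)) hVK hc hωs hXc hXS t
  rw [← mul_sub, norm_mul]
  have hπ : ‖(1 / (2 * (Real.pi : ℂ)))‖ ≤ 1 := by
    rw [norm_div, norm_mul, norm_one, Complex.norm_ofNat, Complex.norm_real, Real.norm_eq_abs,
      abs_of_pos Real.pi_pos]
    exact (div_le_one (by positivity)).mpr (by linarith [Real.pi_gt_three])
  exact (mul_le_of_le_one_left (norm_nonneg _) hπ).trans key
end
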